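/- Let Z, U, Y be complex vector spaces, D ⊆ Z a subspace, G : D → Z and K : D → U linear maps, ω ∈ ℝ, n ≥ 1, and P_0, P_1, …, P_{n−1} : U → Y linear maps. Assume: (i) the map z ↦ P_0(K z), restricted to the eigenspace {z ∈ D : G z = iω z}, is surjective onto Y; and (ii) N_{n−1}(ω,G) ⊆ ran(iω − G). Then for every y⃗ ∈ Y^n there exists z⃗ = (z_n, …, z_1) ∈ D^n with J_n z⃗ = 0 and ℙ(K z_n, …, K z_1) = y⃗. -/

import Mathlib

/-- The generalized kernels `N_l(ω, G)` of `iω − G`: `N_0 = {0}` and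
`N_{l+1} = {z ∈ D : iω z − G z ∈ N_l}`. -/
def genKer {Z : Type*} [AddCommGroup Z] [Module ℂ Z] {D : Submodule ℂ Z}
    (G : D →ₗ[ℂ] Z) (ω : ℝ) : ℕ → Set D
  | 0 => {0}
  | l + 1 => {z | ∃ w ∈ genKer G ω l, (Complex.I * ω) • (z : Z) - G z = (w : Z)}

theorem genKer_neg {Z : Type*} [AddCommGroup Z] [Module ℂ Z] {D : Submodule ℂ Z}
    (G : D →ₗ[ℂ] Z) (ω : ℝ) (l : ℕ) : ∀ z : D, z ∈ genKer G ω l → -z ∈ genKer G ω l := by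
  induction l with
  | zero => 
    intro z hz
    have : z = 0 := hz
    subst this
    show -(0 : D) = 0
    simp
  | succ l ih =>
    rintro z ⟨w, hw, h⟩
    refine ⟨-w, ih w hw, ?_⟩
    rw [map_neg, Submodule.coe_neg, Submodule.coe_neg, ← h, smul_neg]
    abel

theorem genKer_succ {Z : Type*} [AddCommGroup Z] [Module ℂ Z] {D : Submodule ℂ Z}
    (G : D →ₗ[ℂ] Z) (ω : ℝ) (l : ℕ) : genKer G ω l ⊆ genKer G ω (l + 1) := by
  induction l with
  | zero => 
    intro z hz
    have : z = 0 := hz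
    subst this
    exact ⟨0, rfl, by simp⟩
  | succ l ih =>
    rintro z ⟨w, hw, h⟩
    exact ⟨w, ih hw, h⟩

/-- If `P₀ ∘ K` restricted to the eigenspace `ker(iω − G)` is surjective
onto `Y` and `N_{n−1}(ω, G) ⊆ ran(iω − G)`, then the block upper-triangular Toeplitz
operator `ℙ ∘ K` restricted to `ker J_n(ω, G)` is surjective onto `Y^n`.
Tuples are indexed zero-based: `z l` corresponds to `z_{l+1}`, `y m` to `y_{m+1}`. -/
theorem stmt_7 {Z U Y : Type*} [AddCommGroup Z] [Module ℂ Z]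
    [AddCommGroup U] [Module ℂ U] [AddCommGroup Y] [Module ℂ Y]
    (D : Submodule ℂ Z) (G : D →ₗ[ℂ] Z) (K : D →ₗ[ℂ] U)
    (ω : ℝ) (n : ℕ) (hn : 1 ≤ n) (P : ℕ → U →ₗ[ℂ] Y)
    (hsurj : ∀ y : Y, ∃ w : D, G w = (Complex.I * ω) • (w : Z) ∧ P 0 (K w) = y)
    (hran : ∀ z : D, z ∈ genKer G ω (n - 1) →
      (z : Z) ∈ Set.range (fun w : D => (Complex.I * ω) • (w : Z) - G w)) :
    ∀ y : ℕ → Y, ∃ z : ℕ → D,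
      (G (z 0) = (Complex.I * ω) • ((z 0 : Z))) ∧
      (∀ l : ℕ, 1 ≤ l → l < n →
        G (z l) - (Complex.I * ω) • ((z l : Z)) = ((z (l - 1) : Z))) ∧
      (∀ m : ℕ, m < n → ∑ j ∈ Finset.range (m + 1), P j (K (z (m - j))) = y m) := by
  intro y
  have key : ∀ k : ℕ, k < n → ∃ z : ℕ → D, z k ∈ genKer G ω (k + 1) ∧
      (G (z 0) = (Complex.I * ω) • ((z 0 : Z))) ∧
      (∀ l : ℕ, 1 ≤ l → l < k + 1 →
        G (z l) - (Complex.I * ω) • ((z l : Z)) = ((z (l - 1) : Z))) ∧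
      (∀ m : ℕ, m < k + 1 → ∑ j ∈ Finset.range (m + 1), P j (K (z (m - j))) = y m) := by
    intro k
    induction k with
    | zero =>
      intro _
      obtain ⟨w, hw, hy⟩ := hsurj (y 0)
      refine ⟨fun _ => w, ⟨0, rfl, by simp [hw]⟩, hw, fun l h1 h2 => by omega, fun m hm => ?_⟩
      obtain rfl : m = 0 := by omega
      simpa using hy
    | succ k ih =>
      intro hk
      obtain ⟨z, hz, h0, hc, hs⟩ := ih (by omega)
      have hz' : z k ∈ genKer G ω (n - 1) :=
        monotone_nat_of_le_succ (genKer_succ G ω) (show k + 1 ≤ n - 1 by omega) hz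
      obtain ⟨w, hw⟩ := hran _ hz'
      simp only at hw
      obtain ⟨v, hv, hvy⟩ := hsurj (y (k + 1) -
        ∑ j ∈ Finset.range (k + 1), P (j + 1) (K (z (k - j))) + P 0 (K w))
      have hne : ∀ i, i ≤ k → Function.update z (k + 1) (v - w) i = z i := fun i hi =>
        Function.update_of_ne (by omega) _ _
      have heq : Function.update z (k + 1) (v - w) (k + 1) = v - w :=
        Function.update_self _ _ _
      refine ⟨Function.update z (k + 1) (v - w), ?_, ?_, ?_, ?_⟩
      · rw [heq]
        refine ⟨-z k, genKer_neg G ω _ _ hz, ?_⟩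
        rw [Submodule.coe_neg, ← hw, map_sub, hv, Submodule.coe_sub, smul_sub]
        abel
      · rw [hne 0 (by omega)]; exact h0
      · intro l h1 h2
        rcases Nat.lt_or_ge l (k + 1) with h | h
        · rw [hne l (by omega), hne (l - 1) (by omega)]; exact hc l h1 h
        · obtain rfl : l = k + 1 := by omega
          rw [heq, Nat.add_sub_cancel, hne k le_rfl, ← hw, map_sub, hv, Submodule.coe_sub, smul_sub]
          abel
      · intro m hm
        rcases Nat.lt_or_ge m (k + 1) with h | h
        · rw [← hs m h]
          refine Finset.sum_congr rfl fun j _ => ?_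
          rw [hne _ (by omega)]
        · obtain rfl : m = k + 1 := by omega
          rw [Finset.sum_range_succ', Nat.sub_zero, heq, map_sub, map_sub, hvy]
          have : ∑ j ∈ Finset.range (k + 1),
              P (j + 1) (K (Function.update z (k + 1) (v - w) (k + 1 - (j + 1)))) =
              ∑ j ∈ Finset.range (k + 1), P (j + 1) (K (z (k - j))) := by
            refine Finset.sum_congr rfl fun j _ => ?_
            rw [hne _ (by omega), Nat.add_sub_add_right]
          rw [this]
          abel
  obtain ⟨z, -, h0, hc, hs⟩ := key (n - 1) (by omega)
  exact ⟨z, h0, fun l h1 h2 => hc l h1 (by omega), fun m hm => hs m (by omega)⟩
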